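/- For all τ in the complex upper half-plane and all z ∈ ℂ: θ_{0,1}(τ,z)·θ_{1,1}(τ,z) = (η(2τ)²/η(τ))·ϑ10(τ,z). -/

import Mathlib

open Complex

/-- Jacobi theta function `θ_{j,m}(τ,z) = Σ_{n ∈ j/(2m)+ℤ} q^{m n²} e^{2πi m n z}`. -/
noncomputable def jTheta (j m : ℝ) (τ z : ℂ) : ℂ :=
  ∑' n : ℤ, Complex.exp (2 * (Real.pi : ℂ) * Complex.I * (m : ℂ) *
    (((j / (2 * m) + (n : ℝ) : ℝ) : ℂ) ^ 2 * τ + ((j / (2 * m) + (n : ℝ) : ℝ) : ℂ) * z))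

/-- `q^a := e^{2πiaτ}`. -/
noncomputable def qpow (τ : ℂ) (a : ℝ) : ℂ :=
  Complex.exp (2 * (Real.pi : ℂ) * Complex.I * (a : ℂ) * τ)

/-- Dedekind eta function. -/
noncomputable def dedekindEta (τ : ℂ) : ℂ :=
  Complex.exp ((Real.pi : ℂ) * Complex.I * τ / 12) *
    ∏' n : ℕ, (1 - Complex.exp (2 * (Real.pi : ℂ) * Complex.I * ((n : ℂ) + 1) * τ))

/-- Mumford theta `ϑ00`. -/
noncomputable def v00 (τ z : ℂ) : ℂ := jTheta 0 2 τ z + jTheta 2 2 τ z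
/-- Mumford theta `ϑ01`. -/
noncomputable def v01 (τ z : ℂ) : ℂ := jTheta 0 2 τ z - jTheta 2 2 τ z
/-- Mumford theta `ϑ10`. -/
noncomputable def v10 (τ z : ℂ) : ℂ := jTheta 1 2 τ z + jTheta (-1) 2 τ z

open Filter Topology

section GaussIdentity

/-- Partial products of `∏ (1 - t ^ (2 * k)) / (1 - t ^ (2 * k - 1))`. -/
noncomputable def gaussProd (t : ℂ) (n : ℕ) : ℂ :=
  ∏ k ∈ Finset.range n, (1 - t ^ (2 * k + 2)) / (1 - t ^ (2 * k + 1))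

lemma gaussProd_zero (t : ℂ) : gaussProd t 0 = 1 := by simp [gaussProd]

lemma gaussProd_succ (t : ℂ) (n : ℕ) :
    gaussProd t (n + 1) = gaussProd t n * ((1 - t ^ (2 * n + 2)) / (1 - t ^ (2 * n + 1))) :=
  Finset.prod_range_succ _ _

lemma one_sub_pow_succ_ne_zero {t : ℂ} (ht : ‖t‖ < 1) (k : ℕ) : 1 - t ^ (k + 1) ≠ 0 := by
  intro h
  have h1 : ‖t ^ (k + 1)‖ = 1 := by rw [← sub_eq_zero.mp h, norm_one]
  rw [norm_pow] at h1
  exact (pow_lt_one₀ (norm_nonneg t) ht k.succ_ne_zero).ne h1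

lemma gaussProd_ne_zero {t : ℂ} (ht : ‖t‖ < 1) (n : ℕ) : gaussProd t n ≠ 0 :=
  Finset.prod_ne_zero_iff.mpr fun k _ ↦
    div_ne_zero (one_sub_pow_succ_ne_zero ht (2 * k + 1)) (one_sub_pow_succ_ne_zero ht (2 * k))

/-- Shanks' finite form of Gauss' identity for triangular numbers. -/
lemma sum_gaussProd_div {t : ℂ} (ht : ‖t‖ < 1) (n : ℕ) :
    ∑ s ∈ Finset.range n, gaussProd t n / gaussProd t s * t ^ (s * (2 * n + 1)) =
      ∑ m ∈ Finset.range n, (t ^ (m * (2 * m + 1)) + t ^ ((m + 1) * (2 * m + 1))) := by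
  induction n with
  | zero => simp
  | succ n ih =>
    have hn := one_sub_pow_succ_ne_zero ht (2 * n)
    let G : ℕ → ℂ := fun s ↦
      gaussProd t n / gaussProd t s * t ^ (s * (2 * n + 1)) * (1 - t ^ (2 * s)) /
        (1 - t ^ (2 * n + 1))
    have key : ∀ s, gaussProd t (n + 1) / gaussProd t s * t ^ (s * (2 * (n + 1) + 1)) =
        gaussProd t n / gaussProd t s * t ^ (s * (2 * n + 1)) + (G (s + 1) - G s) := by
      intro s
      have hs := gaussProd_ne_zero ht s
      have hs1 := one_sub_pow_succ_ne_zero ht (2 * s)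
      have hs2 := one_sub_pow_succ_ne_zero ht (2 * s + 1)
      have e : 2 * s + 1 + 1 = 2 * s + 2 := rfl
      rw [e] at hs2
      simp only [G, gaussProd_succ]
      rw [show 2 * (s + 1) = 2 * s + 2 by ring]
      field_simp
      ring
    rw [Finset.sum_range_succ, Finset.sum_congr rfl fun s _ ↦ key s, Finset.sum_add_distrib,
      Finset.sum_range_sub, ih, Finset.sum_range_succ]
    have hP := gaussProd_ne_zero ht n
    simp only [G, gaussProd_succ, gaussProd_zero]
    field_simp
    ring

lemma gaussProd_eq {t : ℂ} (ht : ‖t‖ < 1) (n : ℕ) :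
    gaussProd t n = (∏ k ∈ Finset.range n, (1 - (t ^ 2) ^ (k + 1))) ^ 2 /
      ∏ k ∈ Finset.range (2 * n), (1 - t ^ (k + 1)) := by
  induction n with
  | zero => simp [gaussProd]
  | succ n ih =>
    have h1 := one_sub_pow_succ_ne_zero ht (2 * n)
    have h2 := one_sub_pow_succ_ne_zero ht (2 * n + 1)
    have h3 : ∏ k ∈ Finset.range (2 * n), (1 - t ^ (k + 1)) ≠ 0 :=
      Finset.prod_ne_zero_iff.mpr fun k _ ↦ one_sub_pow_succ_ne_zero ht k
    rw [gaussProd_succ, ih, Finset.prod_range_succ, show 2 * (n + 1) = 2 * n + 1 + 1 by ring,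
      Finset.prod_range_succ, Finset.prod_range_succ, ← pow_mul,
      show 2 * (n + 1) = 2 * n + 1 + 1 by ring]
    field_simp

lemma tprod_one_sub_pow_ne_zero {t : ℂ} (ht : ‖t‖ < 1) : ∏' k : ℕ, (1 - t ^ (k + 1)) ≠ 0 := by
  simp_rw [sub_eq_add_neg]
  refine tprod_one_add_ne_zero_of_summable
    (fun k ↦ by simpa [sub_eq_add_neg] using one_sub_pow_succ_ne_zero ht k) ?_
  simpa using (summable_nat_add_iff 1).mpr (summable_geometric_of_lt_one (norm_nonneg _) ht)

lemma norm_sq_lt_one {t : ℂ} (ht : ‖t‖ < 1) : ‖t ^ 2‖ < 1 := by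
  rw [norm_pow]
  exact pow_lt_one₀ (norm_nonneg t) ht two_ne_zero

lemma tendsto_gaussProd {t : ℂ} (ht : ‖t‖ < 1) :
    Tendsto (gaussProd t) atTop
      (𝓝 ((∏' k : ℕ, (1 - (t ^ 2) ^ (k + 1))) ^ 2 / ∏' k : ℕ, (1 - t ^ (k + 1)))) := by
  have h2 := (ModularForm.multipliable_one_sub_pow (norm_sq_lt_one ht)).hasProd.tendsto_prod_nat
  have h1 := (ModularForm.multipliable_one_sub_pow ht).hasProd.tendsto_prod_nat.comp
    (tendsto_id.const_mul_atTop' two_pos)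
  exact ((h2.pow 2).div h1 (tprod_one_sub_pow_ne_zero ht)).congr fun n ↦ (gaussProd_eq ht n).symm

lemma tendsto_sum_inv_gaussProd {t : ℂ} (ht : ‖t‖ < 1) :
    Tendsto (fun n ↦ ∑ s ∈ Finset.range n, (gaussProd t s)⁻¹ * t ^ (s * (2 * n + 1)))
      atTop (𝓝 1) := by
  have hL : (∏' k : ℕ, (1 - (t ^ 2) ^ (k + 1))) ^ 2 / ∏' k : ℕ, (1 - t ^ (k + 1)) ≠ 0 :=
    div_ne_zero (pow_ne_zero 2 (tprod_one_sub_pow_ne_zero (norm_sq_lt_one ht)))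
      (tprod_one_sub_pow_ne_zero ht)
  obtain ⟨C, hC⟩ := (Metric.isBounded_range_of_tendsto _
    ((tendsto_gaussProd ht).inv₀ hL)).exists_norm_le
  replace hC : ∀ s, ‖(gaussProd t s)⁻¹‖ ≤ C := fun s ↦ hC _ ⟨s, rfl⟩
  have hC0 : 0 ≤ C := (norm_nonneg _).trans (hC 0)
  let f : ℕ → ℕ → ℂ := fun n s ↦
    if s ∈ Finset.range n then (gaussProd t s)⁻¹ * t ^ (s * (2 * n + 1)) else 0
  have hlim : Tendsto (fun n ↦ ∑' s, f n s) atTop (𝓝 (∑' s, if s = 0 then (1 : ℂ) else 0)) := by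
    refine tendsto_tsum_of_dominated_convergence (bound := fun s ↦ C * ‖t‖ ^ s)
      ((summable_geometric_of_lt_one (norm_nonneg t) ht).mul_left C) (fun s ↦ ?_)
      (.of_forall fun n s ↦ ?_)
    · have hev : ∀ᶠ n in atTop, (gaussProd t s)⁻¹ * t ^ (s * (2 * n + 1)) = f n s := by
        filter_upwards [eventually_gt_atTop s] with n hn
        simp [f, hn]
      refine Tendsto.congr' hev ?_
      rcases eq_or_ne s 0 with rfl | hs
      · simp [gaussProd_zero]
      · rw [if_neg hs]
        have he : Tendsto (fun n : ℕ ↦ s * (2 * n + 1)) atTop atTop :=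
          tendsto_atTop_mono (fun n ↦ show n ≤ s * (2 * n + 1) by
            nlinarith [Nat.pos_of_ne_zero hs]) tendsto_id
        simpa using ((tendsto_pow_atTop_nhds_zero_of_norm_lt_one ht).comp he).const_mul
          (gaussProd t s)⁻¹
    · by_cases hs : s ∈ Finset.range n
      · simp only [f, if_pos hs, norm_mul, norm_pow]
        exact mul_le_mul (hC s) (pow_le_pow_of_le_one (norm_nonneg t) ht.le (by nlinarith))
          (by positivity) hC0
      · simp only [f, if_neg hs, norm_zero]
        positivity
  rw [tsum_ite_eq] at hlim
  refine hlim.congr fun n ↦ ?_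
  rw [tsum_eq_sum (s := Finset.range n) fun s hs ↦ if_neg hs]
  exact Finset.sum_congr rfl fun s hs ↦ if_pos hs

/-- Gauss' identity for triangular numbers, with consecutive terms paired. -/
lemma tendsto_sum_pow_triangular {t : ℂ} (ht : ‖t‖ < 1) :
    Tendsto (fun n ↦ ∑ m ∈ Finset.range n, (t ^ (m * (2 * m + 1)) + t ^ ((m + 1) * (2 * m + 1))))
      atTop (𝓝 ((∏' k : ℕ, (1 - (t ^ 2) ^ (k + 1))) ^ 2 / ∏' k : ℕ, (1 - t ^ (k + 1)))) := by
  have h := (tendsto_gaussProd ht).mul (tendsto_sum_inv_gaussProd ht)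
  rw [mul_one] at h
  refine h.congr fun n ↦ ?_
  rw [← sum_gaussProd_div ht, Finset.mul_sum]
  exact Finset.sum_congr rfl fun s _ ↦ by ring

end GaussIdentity

section Theta

/-- The summand of `jTheta`. -/
noncomputable def jThetaTerm (j m : ℝ) (τ z : ℂ) (n : ℤ) : ℂ :=
  Complex.exp (2 * (Real.pi : ℂ) * I * (m : ℂ) *
    (((j / (2 * m) + (n : ℝ) : ℝ) : ℂ) ^ 2 * τ + ((j / (2 * m) + (n : ℝ) : ℝ) : ℂ) * z))

lemma jTheta_eq_tsum (j m : ℝ) (τ z : ℂ) : jTheta j m τ z = ∑' n, jThetaTerm j m τ z n := rfl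

lemma summable_jThetaTerm (j : ℝ) {m : ℝ} (hm : 0 < m) {τ : ℂ} (hτ : 0 < τ.im) (z : ℂ) :
    Summable (jThetaTerm j m τ z) := by
  have hm' : (m : ℂ) ≠ 0 := mod_cast hm.ne'
  have him : 0 < (2 * m * τ).im := by
    have : (2 * m * τ).im = 2 * m * τ.im := by simp
    rw [this]
    positivity
  refine (((summable_jacobiTheta₂_term_iff (j * τ + m * z) (2 * m * τ)).mpr him).mul_left
    (Complex.exp (2 * Real.pi * I * m * ((j / (2 * m)) ^ 2 * τ + j / (2 * m) * z)))).congr fun n ↦ ?_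
  rw [jacobiTheta₂_term, jThetaTerm, ← Complex.exp_add]
  congr 1
  push_cast
  field_simp
  ring

lemma jTheta_neg_one_zero (τ : ℂ) : jTheta (-1) 2 τ 0 = jTheta 1 2 τ 0 := by
  rw [jTheta_eq_tsum, jTheta_eq_tsum]
  rw [← (Equiv.neg ℤ).tsum_eq]
  refine tsum_congr fun n ↦ ?_
  simp only [jThetaTerm, Equiv.neg_apply]
  congr 1
  push_cast
  ring

/-- `(k, l) ↦ (k + l, k - l)`, a bijection onto the pairs of integers of equal parity. -/
def evenPair (p : ℤ × ℤ) : ℤ × ℤ := (p.1 + p.2, p.1 - p.2)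

/-- `(k, l) ↦ (k + l, k - l - 1)`, a bijection onto the pairs of integers of distinct parity. -/
def oddPair (p : ℤ × ℤ) : ℤ × ℤ := (p.1 + p.2, p.1 - p.2 - 1)

lemma evenPair_injective : Function.Injective evenPair := by
  rintro ⟨a, b⟩ ⟨c, d⟩ h
  simp only [evenPair, Prod.mk.injEq] at h ⊢
  omega

lemma oddPair_injective : Function.Injective oddPair := by
  rintro ⟨a, b⟩ ⟨c, d⟩ h
  simp only [oddPair, Prod.mk.injEq] at h ⊢
  omega

lemma isCompl_range_evenPair_oddPair : IsCompl (Set.range evenPair) (Set.range oddPair) := by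
  rw [← compl_eq_iff_isCompl]
  ext ⟨a, b⟩
  simp only [Set.mem_compl_iff, Set.mem_range, evenPair, oddPair, Prod.exists, Prod.mk.injEq]
  constructor
  · intro h
    rcases Int.even_or_odd' (a + b) with ⟨c, hc | hc⟩
    · exact absurd ⟨c, a - c, by omega, by omega⟩ h
    · exact ⟨c + 1, a - c - 1, by omega, by omega⟩
  · rintro ⟨k, l, h1, h2⟩ ⟨k', l', h3, h4⟩
    omega

lemma hasSum_jTheta_mul_jTheta (j j' : ℝ) {m m' : ℝ} (hm : 0 < m) (hm' : 0 < m') {τ : ℂ}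
    (hτ : 0 < τ.im) (z z' : ℂ) :
    HasSum (fun p : ℤ × ℤ ↦ jThetaTerm j m τ z p.1 * jThetaTerm j' m' τ z' p.2)
      (jTheta j m τ z * jTheta j' m' τ z') := by
  have h := (summable_jThetaTerm j hm hτ z).norm
  have h' := (summable_jThetaTerm j' hm' hτ z').norm
  rw [jTheta_eq_tsum, jTheta_eq_tsum, tsum_mul_tsum_of_summable_norm h h']
  exact (summable_mul_of_summable_norm h h').hasSum

lemma HasSum.of_evenPair_of_oddPair {F : ℤ × ℤ → ℂ} {a b : ℂ} (ha : HasSum (F ∘ evenPair) a)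
    (hb : HasSum (F ∘ oddPair) b) : HasSum F (a + b) :=
  HasSum.add_isCompl isCompl_range_evenPair_oddPair
    (evenPair_injective.hasSum_range_iff.mpr ha) (oddPair_injective.hasSum_range_iff.mpr hb)

lemma jThetaTerm_mul_evenPair (τ z : ℂ) (p : ℤ × ℤ) :
    jThetaTerm 0 1 τ z (evenPair p).1 * jThetaTerm 1 1 τ z (evenPair p).2 =
      jThetaTerm 1 2 τ z p.1 * jThetaTerm (-1) 2 τ 0 p.2 := by
  simp only [evenPair, jThetaTerm, ← Complex.exp_add]
  congr 1
  push_cast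
  ring

lemma jThetaTerm_mul_oddPair (τ z : ℂ) (p : ℤ × ℤ) :
    jThetaTerm 0 1 τ z (oddPair p).1 * jThetaTerm 1 1 τ z (oddPair p).2 =
      jThetaTerm (-1) 2 τ z p.1 * jThetaTerm 1 2 τ 0 p.2 := by
  simp only [oddPair, jThetaTerm, ← Complex.exp_add]
  congr 1
  push_cast
  ring

lemma jTheta_zero_one_mul_jTheta_one_one {τ : ℂ} (hτ : 0 < τ.im) (z : ℂ) :
    jTheta 0 1 τ z * jTheta 1 1 τ z =
      jTheta 1 2 τ z * jTheta (-1) 2 τ 0 + jTheta (-1) 2 τ z * jTheta 1 2 τ 0 := by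
  have h := hasSum_jTheta_mul_jTheta 0 1 one_pos one_pos hτ z z
  have he := hasSum_jTheta_mul_jTheta 1 (-1) two_pos two_pos hτ z 0
  have ho := hasSum_jTheta_mul_jTheta (-1) 1 two_pos two_pos hτ z 0
  simp_rw [← jThetaTerm_mul_evenPair] at he
  simp_rw [← jThetaTerm_mul_oddPair] at ho
  exact h.unique (HasSum.of_evenPair_of_oddPair he ho)

lemma norm_exp_two_pi_I_mul_lt_one {τ : ℂ} (hτ : 0 < τ.im) :
    ‖Complex.exp (2 * Real.pi * I * τ)‖ < 1 :=
  UpperHalfPlane.norm_exp_two_pi_I_lt_one ⟨τ, hτ⟩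

lemma dedekindEta_eq (τ : ℂ) :
    dedekindEta τ = Complex.exp (Real.pi * I * τ / 12) *
      ∏' n : ℕ, (1 - Complex.exp (2 * Real.pi * I * τ) ^ (n + 1)) := by
  rw [dedekindEta]
  congr 1
  refine tprod_congr fun n ↦ ?_
  rw [← Complex.exp_nat_mul]
  congr 2
  push_cast
  ring

lemma jTheta_one_two_zero {τ : ℂ} (hτ : 0 < τ.im) :
    jTheta 1 2 τ 0 = dedekindEta (2 * τ) ^ 2 / dedekindEta τ := by
  set t := Complex.exp (2 * Real.pi * I * τ) with ht
  have ht1 : ‖t‖ < 1 := norm_exp_two_pi_I_mul_lt_one hτ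
  have hinj : Function.Injective fun n : ℕ ↦ (-(n + 1 : ℤ)) := fun a b h ↦ by simpa using h
  have hs := summable_jThetaTerm 1 two_pos hτ 0
  have hpos := hs.comp_injective Nat.cast_injective
  have hneg := hs.comp_injective hinj
  have hlim : Tendsto (fun n ↦ Complex.exp (Real.pi * I * τ / 4) * ∑ m ∈ Finset.range n,
      (t ^ (m * (2 * m + 1)) + t ^ ((m + 1) * (2 * m + 1)))) atTop (𝓝 (jTheta 1 2 τ 0)) := by
    have h := (hpos.hasSum.add hneg.hasSum).tendsto_sum_nat
    rw [jTheta_eq_tsum, tsum_of_nat_of_neg_add_one hpos hneg]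
    refine h.congr fun n ↦ ?_
    rw [Finset.mul_sum]
    refine Finset.sum_congr rfl fun m _ ↦ ?_
    simp only [Function.comp_apply, jThetaTerm, ht, ← Complex.exp_nat_mul, mul_add (Complex.exp _),
      ← Complex.exp_add]
    congr 2 <;> push_cast <;> ring
  rw [tendsto_nhds_unique hlim ((tendsto_sum_pow_triangular ht1).const_mul _), dedekindEta_eq,
    dedekindEta_eq, show Complex.exp (2 * Real.pi * I * (2 * τ)) = t ^ 2 by
      rw [ht, ← Complex.exp_nat_mul]; congr 1; push_cast; ring, ← ht, mul_pow, mul_div_mul_comm,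
    ← Complex.exp_nat_mul (Real.pi * I * (2 * τ) / 12), ← Complex.exp_sub]
  congr 2
  push_cast
  ring

end Theta

/-- Note 2.4 (3): `θ_{0,1}(τ,z)·θ_{1,1}(τ,z)`. -/
theorem stmt_12 (τ : ℂ) (hτ : 0 < τ.im) (z : ℂ) :
    jTheta 0 1 τ z * jTheta 1 1 τ z =
      (dedekindEta (2 * τ) ^ 2 / dedekindEta τ) * v10 τ z := by
  rw [jTheta_zero_one_mul_jTheta_one_one hτ, jTheta_neg_one_zero, jTheta_one_two_zero hτ, v10]
  ring
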